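/- arXiv:2307.02021 — 2 statements merged into one kernel-verified Lean document; each statement's English description precedes it below -/
import Mathlib

section
/- Let H be a finite nonempty cluster graph, let a be the maximum number of vertices in a connected component of H, and let b be the number of components of H with exactly a vertices. Let R be the graph obtained from H by deleting exactly one vertex from each component of size a. Then f^H(x) = f^R(x − b) for every integer x with b ≤ x ≤ |V(H)|. -/
namespace Stmt16

/-- A cluster graph: every connected component is a complete graph. -/
def IsClusterGraph {α : Type} (W : SimpleGraph α) : Prop :=
  ∀ u v : α, W.Reachable u v → u ≠ v → W.Adj u v

/-- The degree deletion function of `W`: the minimum possible maximum degree of the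
graph obtained from `W` by deleting a set of `x` vertices. -/
noncomputable def fdel {α : Type} (W : SimpleGraph α) (x : ℕ) : ℕ :=
  sInf {m | ∃ Y : Set α, Y.ncard = x ∧ ∀ v, ((W.induce Yᶜ).neighborSet v).ncard ≤ m}

/-- A set `Y` can be replaced by a superset `Z` of `D` that meets every fibre of `f` in as many
points as `Y` does, provided `D` meets no fibre in more points than `Y`. -/
lemma exists_superset_ncard_fiber_eq {α κ : Type*} [Finite α] (f : α → κ) (D Y : Set α)
    (h : ∀ k, (f ⁻¹' {k} ∩ D).ncard ≤ (f ⁻¹' {k} ∩ Y).ncard) :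
    ∃ Z : Set α, D ⊆ Z ∧ Z.ncard = Y.ncard ∧
      ∀ k, (f ⁻¹' {k} \ Z).ncard = (f ⁻¹' {k} \ Y).ncard := by
  classical
  have := Fintype.ofFinite α
  have hex : ∀ k, ∃ u : Set α, f ⁻¹' {k} ∩ D ⊆ u ∧ u ⊆ f ⁻¹' {k} ∧
      u.ncard = (f ⁻¹' {k} ∩ Y).ncard := fun k =>
    Set.exists_subsuperset_card_eq Set.inter_subset_left (h k)
      (Set.ncard_le_ncard Set.inter_subset_left)
  choose u hDu hu hcard using hex
  have hfib : ∀ k, f ⁻¹' {k} ∩ {v | v ∈ u (f v)} = u k := by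
    intro k
    ext v
    constructor
    · rintro ⟨rfl, hv⟩
      exact hv
    · intro hv
      obtain rfl : f v = k := hu k hv
      exact ⟨rfl, hv⟩
  have hsum : ∀ S : Set α, S.ncard =
      ∑ k ∈ Finset.univ.image f, (f ⁻¹' {k} ∩ S).ncard := by
    intro S
    rw [Set.ncard_eq_toFinset_card', Finset.card_eq_sum_card_fiberwise (f := f)
      (t := Finset.univ.image f) (fun v _ => by simp)]
    refine Finset.sum_congr rfl fun k _ => ?_
    rw [Set.ncard_eq_toFinset_card']
    congr 1
    ext v
    simp [and_comm]
  refine ⟨{v | v ∈ u (f v)}, fun v hv => hDu _ ⟨rfl, hv⟩, ?_, fun k => ?_⟩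
  · rw [hsum, hsum Y]
    exact Finset.sum_congr rfl fun k _ => by rw [hfib, hcard]
  · have h₁ := Set.ncard_inter_add_ncard_sdiff_eq_ncard (f ⁻¹' {k}) {v | v ∈ u (f v)}
    have h₂ := Set.ncard_inter_add_ncard_sdiff_eq_ncard (f ⁻¹' {k}) Y
    rw [hfib, hcard] at h₁
    omega

lemma ncard_neighborSet_induce_compl {α : Type*} (W : SimpleGraph α) (Y : Set α)
    (v : (Yᶜ : Set α)) :
    ((W.induce Yᶜ).neighborSet v).ncard = (W.neighborSet v \ Y).ncard := by
  rw [← Set.ncard_image_of_injective _ Subtype.val_injective]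
  congr 1
  ext w
  simp [and_comm]

lemma ncard_neighborSet_induce_compl_diff {α : Type*} (W : SimpleGraph α) (D : Set α)
    (Y : Set (Dᶜ : Set α)) (v : (Dᶜ : Set α)) :
    ((W.induce Dᶜ).neighborSet v \ Y).ncard =
      (W.neighborSet v \ (D ∪ Subtype.val '' Y)).ncard := by
  rw [← Set.ncard_image_of_injective _ Subtype.val_injective]
  congr 1
  ext w
  simp only [Set.mem_image, Set.mem_sdiff, SimpleGraph.mem_neighborSet, SimpleGraph.comap_adj,
    Function.Embedding.subtype_apply, Subtype.exists, Set.mem_union, Set.mem_compl_iff]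
  grind

lemma fdel_eq_sInf {α : Type} (W : SimpleGraph α) (x : ℕ) :
    fdel W x = sInf {m | ∃ Y : Set α, Y.ncard = x ∧
      ∀ v ∉ Y, (W.neighborSet v \ Y).ncard ≤ m} := by
  simp only [fdel, ncard_neighborSet_induce_compl, Subtype.forall, Set.mem_compl_iff]

lemma fdel_induce_compl_eq_sInf {α : Type} [Finite α] (W : SimpleGraph α) (D : Set α) {x : ℕ}
    (hx : D.ncard ≤ x) :
    fdel (W.induce Dᶜ) (x - D.ncard) = sInf {m | ∃ Z : Set α, D ⊆ Z ∧ Z.ncard = x ∧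
      ∀ v ∉ Z, (W.neighborSet v \ Z).ncard ≤ m} := by
  rw [fdel_eq_sInf]
  congr 1
  ext m
  simp only [ncard_neighborSet_induce_compl_diff, Set.mem_ofPred_eq]
  constructor
  · rintro ⟨Y, hY, hdeg⟩
    refine ⟨D ∪ Subtype.val '' Y, Set.subset_union_left, ?_, fun v hv => ?_⟩
    · rw [Set.ncard_union_eq, Set.ncard_image_of_injective _ Subtype.val_injective, hY]
      · omega
      · rw [Set.disjoint_right]
        rintro _ ⟨w, -, rfl⟩
        exact w.2
    · rw [Set.mem_union, not_or] at hv
      exact hdeg ⟨v, hv.1⟩ fun h => hv.2 ⟨_, h, rfl⟩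
  · rintro ⟨Z, hDZ, hZ, hdeg⟩
    have himg : (Subtype.val '' (Subtype.val ⁻¹' Z : Set (Dᶜ : Set α))) = Z \ D := by
      rw [Subtype.image_preimage_coe, Set.sdiff_eq, Set.inter_comm]
    refine ⟨Subtype.val ⁻¹' Z, ?_, fun v hv => ?_⟩
    · rw [← Set.ncard_image_of_injective _ Subtype.val_injective, himg,
        Set.ncard_sdiff hDZ, hZ]
    · rw [himg, Set.union_sdiff_cancel hDZ]
      exact hdeg v hv

lemma IsClusterGraph.ncard_neighborSet_diff_add_one {α : Type} [Finite α] {W : SimpleGraph α}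
    (hW : IsClusterGraph W) {Z : Set α} {v : α} (hv : v ∉ Z) :
    (W.neighborSet v \ Z).ncard + 1 = ((W.connectedComponentMk v).supp \ Z).ncard := by
  have hmem : v ∈ (W.connectedComponentMk v).supp \ Z := ⟨rfl, hv⟩
  rw [← Set.ncard_sdiff_singleton_add_one hmem]
  congr 2
  ext w
  simp only [Set.mem_sdiff, SimpleGraph.mem_neighborSet, SimpleGraph.ConnectedComponent.mem_supp_iff,
    SimpleGraph.ConnectedComponent.eq, Set.mem_singleton_iff]
  constructor
  · rintro ⟨hadj, hw⟩
    exact ⟨⟨hadj.reachable.symm, hw⟩, hadj.ne'⟩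
  · rintro ⟨⟨hr, hw⟩, hne⟩
    exact ⟨hW v w hr.symm (Ne.symm hne), hw⟩

lemma IsClusterGraph.forall_ncard_neighborSet_diff_le_iff {α : Type} [Finite α]
    {W : SimpleGraph α} (hW : IsClusterGraph W) (Z : Set α) (m : ℕ) :
    (∀ v ∉ Z, (W.neighborSet v \ Z).ncard ≤ m) ↔
      ∀ c : W.ConnectedComponent, (c.supp \ Z).ncard ≤ m + 1 := by
  constructor
  · intro h c
    rcases (c.supp \ Z).eq_empty_or_nonempty with he | ⟨v, rfl, hv⟩
    · simp [he]
    · rw [← hW.ncard_neighborSet_diff_add_one hv]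
      exact Nat.succ_le_succ (h v hv)
  · intro h v hv
    have := h (W.connectedComponentMk v)
    rw [← hW.ncard_neighborSet_diff_add_one hv] at this
    omega

/-- let `H` be a finite nonempty cluster graph, `a` the maximum number of
vertices of a component, `b` the number of components with exactly `a` vertices, and `D`
a set of vertices containing exactly one vertex of each component of size `a` and no
other vertex.  Then `f^H(x) = f^{H - D}(x - b)` for all `b ≤ x ≤ |V(H)|`. -/
theorem cluster_fdel_reduce (V : Type) [Fintype V] [Nonempty V] (H : SimpleGraph V)
    (hclu : IsClusterGraph H)
    (a b : ℕ)
    (ha1 : ∀ c : H.ConnectedComponent, c.supp.ncard ≤ a)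
    (ha2 : ∃ c : H.ConnectedComponent, c.supp.ncard = a)
    (hb : b = Nat.card {c : H.ConnectedComponent // c.supp.ncard = a})
    (D : Set V)
    (hD1 : ∀ c : H.ConnectedComponent, c.supp.ncard = a → ∃! w, w ∈ D ∧ w ∈ c.supp)
    (hD2 : ∀ w ∈ D, (H.connectedComponentMk w).supp.ncard = a)
    (x : ℕ) (hxb : b ≤ x) (hxV : x ≤ Fintype.card V) :
    fdel H x = fdel (H.induce Dᶜ) (x - b) := by
  have hDb : D.ncard = b := by
    rw [hb, ← Nat.card_coe_set_eq]
    refine Nat.card_congr (Equiv.ofBijective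
      (fun w => ⟨H.connectedComponentMk w, hD2 w w.2⟩) ⟨fun w w' h => ?_, fun c => ?_⟩)
    · exact Subtype.ext ((hD1 _ (hD2 w w.2)).unique ⟨w.2, rfl⟩
        ⟨w'.2, (congrArg Subtype.val h).symm⟩)
    · obtain ⟨w, hw, -⟩ := hD1 c.1 c.2
      exact ⟨⟨w, hw.1⟩, Subtype.ext hw.2⟩
  subst hDb
  rw [fdel_induce_compl_eq_sInf H D hxb, fdel_eq_sInf]
  congr 1
  ext m
  simp only [hclu.forall_ncard_neighborSet_diff_le_iff, Set.mem_ofPred_eq]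
  refine ⟨?_, fun ⟨Z, _, hZ⟩ => ⟨Z, hZ⟩⟩
  rintro ⟨Y, rfl, hY⟩
  by_cases ham : a ≤ m + 1
  · obtain ⟨Z, hDZ, -, hZ⟩ := Set.exists_subsuperset_card_eq (Set.subset_univ D) hxb
      (Set.ncard_le_ncard (Set.subset_univ Y))
    exact ⟨Z, hDZ, hZ, fun c =>
      (Set.ncard_le_ncard Set.sdiff_subset).trans ((ha1 c).trans ham)⟩
  · have hfib : ∀ c : H.ConnectedComponent, (c.supp ∩ D).ncard ≤ (c.supp ∩ Y).ncard := by
      intro c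
      by_cases hc : c.supp.ncard = a
      · have hD : (c.supp ∩ D).ncard ≤ 1 := (Set.ncard_le_one_iff).2 fun hv hw =>
          (hD1 c hc).unique hv.symm hw.symm
        have := Set.ncard_inter_add_ncard_sdiff_eq_ncard c.supp Y
        have := hY c
        omega
      · have hD : c.supp ∩ D = ∅ := by
          rw [Set.eq_empty_iff_forall_notMem]
          rintro w ⟨rfl, hw⟩
          exact hc (hD2 w hw)
        simp [hD]
    obtain ⟨Z, hDZ, hZ, hZY⟩ :=
      exists_superset_ncard_fiber_eq H.connectedComponentMk D Y hfib
    exact ⟨Z, hDZ, hZ, fun c => (hZY c).trans_le (hY c)⟩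

end Stmt16
end

section
/- Let G be a finite cluster graph whose components consist of, for each i ∈ {1, …, r}, exactly b_i ≥ 1 complete graphs on a_i + 1 vertices, where a_1 > a_2 > … > a_r > a_{r+1} = 0, together with b_{r+1} ≥ 0 isolated vertices. For i ∈ {1, …, r+1} set x_i = Σ_{j=1}^{i} (a_j − a_i)·b_j. Then: (1) f^G(x) = 0 for every integer x with x_{r+1} ≤ x ≤ |V(G)|; (2) for every i ∈ {1, …, r} and every integer x with x_i ≤ x < x_{i+1}, f^G(x) = a_i − ⌊(x − x_i)/(b_1 + … + b_i)⌋. -/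
namespace Stmt17

/-- The degree deletion function of `W`: the minimum possible maximum degree of the
graph obtained from `W` by deleting a set of `x` vertices. -/
noncomputable def fdel {α : Type} (W : SimpleGraph α) (x : ℕ) : ℕ :=
  sInf {m | ∃ Y : Set α, Y.ncard = x ∧ ∀ v, ((W.induce Yᶜ).neighborSet v).ncard ≤ m}

/-- The vertex type of the cluster graph consisting of, for each `i ∈ {1, …, r+1}`,
exactly `b i` complete graphs on `a i + 1` vertices. -/
abbrev VC (r : ℕ) (a b : ℕ → ℕ) : Type :=
  Σ i : Fin (r + 1), Fin (b (i.1 + 1)) × Fin (a (i.1 + 1) + 1)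

/-- The cluster graph consisting of, for each `i ∈ {1, …, r+1}`, exactly `b i` complete
graphs on `a i + 1` vertices: two vertices are adjacent iff they are distinct vertices
of the same copy. -/
def clusterG (r : ℕ) (a b : ℕ → ℕ) : SimpleGraph (VC r a b) :=
  SimpleGraph.fromRel fun x y =>
    ∃ (i : Fin (r + 1)) (cp : Fin (b (i.1 + 1))) (u w : Fin (a (i.1 + 1) + 1)),
      x = ⟨i, (cp, u)⟩ ∧ y = ⟨i, (cp, w)⟩

/-- In a graph whose components are the fibres of `κ`, each complete, deleting `Y` leaves maximum
degree at most `m` iff at most `m + 1` vertices of each fibre survive. -/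
theorem induce_compl_degree_le_iff {α K : Type} [Fintype α] [DecidableEq α] [DecidableEq K]
    {W : SimpleGraph α} {κ : α → K} (hW : ∀ x y, W.Adj x y ↔ x ≠ y ∧ κ x = κ y)
    (Y : Finset α) (m : ℕ) :
    (∀ v, ((W.induce (Y : Set α)ᶜ).neighborSet v).ncard ≤ m) ↔
      ∀ k, (Finset.univ.filter fun v => κ v = k ∧ v ∉ Y).card ≤ m + 1 := by
  have key : ∀ v : ((Y : Set α)ᶜ : Set α), ((W.induce (Y : Set α)ᶜ).neighborSet v).ncard =
      (Finset.univ.filter fun w => κ w = κ v ∧ w ∉ Y).card - 1 := by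
    intro v
    have hv : (v : α) ∉ Y := fun h => v.2 (Finset.mem_coe.2 h)
    rw [← Finset.card_erase_of_mem (a := (v : α)) (by simp [hv]), ← Set.ncard_coe_finset,
      ← Set.ncard_image_of_injective _ Subtype.val_injective]
    congr 1
    ext w
    simp only [Set.mem_image, SimpleGraph.mem_neighborSet, SimpleGraph.comap_adj, hW,
      Function.Embedding.subtype_apply, Finset.coe_erase, Finset.coe_filter, Set.mem_sdiff,
      Set.mem_ofPred_eq, Set.mem_singleton_iff, Finset.mem_univ, true_and]
    constructor
    · rintro ⟨u, ⟨hne, heq⟩, rfl⟩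
      exact ⟨⟨heq.symm, fun h => u.2 (Finset.mem_coe.2 h)⟩, fun h => hne h.symm⟩
    · rintro ⟨⟨heq, hw⟩, hne⟩
      exact ⟨⟨w, by simpa using hw⟩, ⟨fun h => hne h.symm, heq.symm⟩, rfl⟩
  constructor
  · intro h k
    rcases Finset.eq_empty_or_nonempty (Finset.univ.filter fun v => κ v = k ∧ v ∉ Y) with h0 | h0
    · simp [h0]
    · obtain ⟨v, hv⟩ := h0
      simp only [Finset.mem_filter, Finset.mem_univ, true_and] at hv
      have h1 := h ⟨v, by simpa using hv.2⟩
      rw [key] at h1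
      simp only [hv.1] at h1
      omega
  · intro h v
    rw [key]
    have := h (κ v)
    omega

/-- Deleting `x` vertices can bring the maximum degree of a cluster graph down to `m` iff `x` is at
least the total excess of the component sizes over `m + 1`. -/
theorem exists_ncard_degree_le_iff {α K : Type} [Fintype α] [Fintype K] [DecidableEq K]
    {W : SimpleGraph α} {κ : α → K} (hW : ∀ x y, W.Adj x y ↔ x ≠ y ∧ κ x = κ y)
    {x : ℕ} (hx : x ≤ Fintype.card α) (m : ℕ) :
    (∃ Y : Set α, Y.ncard = x ∧ ∀ v, ((W.induce Yᶜ).neighborSet v).ncard ≤ m) ↔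
      ∑ k, ((Finset.univ.filter fun v => κ v = k).card - (m + 1)) ≤ x := by
  classical
  have split : ∀ (Y : Finset α) (k : K), (Finset.univ.filter fun v => κ v = k).card =
      (Y.filter fun v => κ v = k).card +
        (Finset.univ.filter fun v => κ v = k ∧ v ∉ Y).card := by
    intro Y k
    rw [← Finset.card_filter_add_card_filter_not (s := Finset.univ.filter fun v => κ v = k)
      (fun v => v ∈ Y), Finset.filter_filter, Finset.filter_filter]
    congr 2
    ext v
    simp [and_comm]
  have total : ∀ Y : Finset α, Y.card = ∑ k, (Y.filter fun v => κ v = k).card := fun Y =>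
    Finset.card_eq_sum_card_fiberwise fun _ _ => Finset.mem_coe.2 (Finset.mem_univ _)
  constructor
  · rintro ⟨Y, rfl, hY⟩
    lift Y to Finset α using Y.toFinite
    rw [induce_compl_degree_le_iff hW] at hY
    rw [Set.ncard_coe_finset, total]
    refine Finset.sum_le_sum fun k _ => ?_
    have := hY k
    have := split Y k
    omega
  · intro h
    choose S hS hcard using fun k : K => Finset.exists_subset_card_eq
      (s := Finset.univ.filter fun v => κ v = k) (Nat.sub_le _ (m + 1))
    have hfib : ∀ k, S k ⊆ (Finset.univ.biUnion S).filter fun v => κ v = k := fun k v hv =>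
      Finset.mem_filter.2 ⟨Finset.mem_biUnion.2 ⟨k, Finset.mem_univ _, hv⟩,
        (Finset.mem_filter.1 (hS k hv)).2⟩
    have h0 : (Finset.univ.biUnion S).card ≤ x :=
      Finset.card_biUnion_le.trans (by simpa only [hcard] using h)
    obtain ⟨Y, hSY, hYx⟩ := Finset.exists_superset_card_eq h0 hx
    refine ⟨Y, by rw [Set.ncard_coe_finset, hYx], ?_⟩
    rw [induce_compl_degree_le_iff hW]
    intro k
    have h1 := Finset.card_le_card ((hfib k).trans (Finset.filter_subset_filter _ hSY))
    rw [hcard] at h1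
    have := split Y k
    omega

theorem clusterG_adj (r : ℕ) (a b : ℕ → ℕ) (x y : VC r a b) :
    (clusterG r a b).Adj x y ↔ x ≠ y ∧
      (⟨x.1, x.2.1⟩ : Σ i : Fin (r + 1), Fin (b (i.1 + 1))) = ⟨y.1, y.2.1⟩ := by
  rw [clusterG, SimpleGraph.fromRel_adj]
  refine and_congr_right fun _ => ⟨?_, ?_⟩
  · rintro (⟨i, c, u, w, rfl, rfl⟩ | ⟨i, c, u, w, rfl, rfl⟩) <;> rfl
  · obtain ⟨i, c, u⟩ := x
    obtain ⟨j, d, w⟩ := y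
    intro h
    obtain ⟨rfl, h⟩ := Sigma.mk.inj_iff.1 h
    obtain rfl := eq_of_heq h
    exact Or.inl ⟨i, c, u, w, rfl, rfl⟩

theorem card_clusterG_component (r : ℕ) (a b : ℕ → ℕ)
    (k : Σ i : Fin (r + 1), Fin (b (i.1 + 1))) :
    (Finset.univ.filter fun v : VC r a b =>
      (⟨v.1, v.2.1⟩ : Σ i : Fin (r + 1), Fin (b (i.1 + 1))) = k).card = a (k.1.1 + 1) + 1 := by
  obtain ⟨i, c⟩ := k
  have : (Finset.univ.filter fun v : VC r a b =>
      (⟨v.1, v.2.1⟩ : Σ i : Fin (r + 1), Fin (b (i.1 + 1))) = ⟨i, c⟩) =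
      Finset.univ.image fun u : Fin (a (i.1 + 1) + 1) => (⟨i, (c, u)⟩ : VC r a b) := by
    ext ⟨j, d, w⟩
    simp only [Finset.mem_filter, Finset.mem_univ, true_and, Finset.mem_image]
    constructor
    · intro h
      obtain ⟨rfl, h⟩ := Sigma.mk.inj_iff.1 h
      obtain rfl := eq_of_heq h
      exact ⟨w, rfl⟩
    · rintro ⟨u, h⟩
      cases h
      rfl
  rw [this, Finset.card_image_of_injective, Finset.card_univ, Fintype.card_fin]
  intro u w h
  simpa using h

theorem clusterG_exists_iff (r : ℕ) (a b : ℕ → ℕ) {x : ℕ}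
    (hx : x ≤ Fintype.card (VC r a b)) (m : ℕ) :
    (∃ Y : Set (VC r a b), Y.ncard = x ∧
      ∀ v, (((clusterG r a b).induce Yᶜ).neighborSet v).ncard ≤ m) ↔
      ∑ j ∈ Finset.Icc 1 (r + 1), (a j - m) * b j ≤ x := by
  rw [exists_ncard_degree_le_iff (clusterG_adj r a b) hx]
  simp only [card_clusterG_component, Nat.add_sub_add_right]
  rw [Fintype.sum_sigma, ← Finset.Ico_add_one_right_eq_Icc, Finset.sum_Ico_eq_sum_range,
    Nat.add_sub_cancel, Finset.sum_range]
  simp [add_comm, mul_comm]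

/-- The total excess over `m` is antitone in `m`. -/
theorem sum_tsub_mul_antitone (s : Finset ℕ) (a b : ℕ → ℕ) :
    Antitone fun m => ∑ j ∈ s, (a j - m) * b j := fun _ _ h =>
  Finset.sum_le_sum fun _ _ => Nat.mul_le_mul_right _ (Nat.sub_le_sub_left h _)

theorem sum_excess_le_card (r : ℕ) (a b : ℕ → ℕ) (m : ℕ) :
    ∑ j ∈ Finset.Icc 1 (r + 1), (a j - m) * b j ≤ Fintype.card (VC r a b) := by
  rw [← clusterG_exists_iff r a b le_rfl]
  refine ⟨Set.univ, by rw [Set.ncard_univ, Nat.card_eq_fintype_card], fun v => ?_⟩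
  exact absurd (Set.mem_univ _) v.2

theorem fdel_clusterG_le {r : ℕ} {a b : ℕ → ℕ} {x m : ℕ}
    (hx : x ≤ Fintype.card (VC r a b))
    (h : ∑ j ∈ Finset.Icc 1 (r + 1), (a j - m) * b j ≤ x) : fdel (clusterG r a b) x ≤ m :=
  Nat.sInf_le ((clusterG_exists_iff r a b hx m).2 h)

theorem sum_excess_fdel_le {r : ℕ} {a b : ℕ → ℕ} {x : ℕ}
    (hx : x ≤ Fintype.card (VC r a b)) {m : ℕ}
    (h : ∑ j ∈ Finset.Icc 1 (r + 1), (a j - m) * b j ≤ x) :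
    ∑ j ∈ Finset.Icc 1 (r + 1), (a j - fdel (clusterG r a b) x) * b j ≤ x :=
  (clusterG_exists_iff r a b hx _).1
    (Nat.sInf_mem (s := {m | ∃ Y : Set (VC r a b), Y.ncard = x ∧
      ∀ v, (((clusterG r a b).induce Yᶜ).neighborSet v).ncard ≤ m})
      ⟨m, (clusterG_exists_iff r a b hx m).2 h⟩)

theorem antitone_of_succ_lt {r : ℕ} {a : ℕ → ℕ} (ha : ∀ i, 1 ≤ i → i ≤ r → a (i + 1) < a i)
    {j i : ℕ} (hj : 1 ≤ j) (hji : j ≤ i) (hi : i ≤ r + 1) : a i ≤ a j := by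
  induction i, hji using Nat.le_induction with
  | base => exact le_rfl
  | succ n hn ih => exact (ha n (hj.trans hn) (by omega)).le.trans (ih (by omega))

/-- Between consecutive values `a (i + 1) ≤ m ≤ a i`, the total excess is linear in `m`. -/
theorem sum_excess_eq {r : ℕ} {a b : ℕ → ℕ} (ha : ∀ i, 1 ≤ i → i ≤ r → a (i + 1) < a i)
    {i m n : ℕ} (hi : i ≤ n) (hn : n ≤ r + 1) (hir : i ≤ r)
    (hm : a (i + 1) ≤ m) (hmi : m ≤ a i) :
    ∑ j ∈ Finset.Icc 1 n, (a j - m) * b j =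
      ∑ j ∈ Finset.Icc 1 i, (a j - a i) * b j + (a i - m) * ∑ j ∈ Finset.Icc 1 i, b j := by
  rw [Finset.mul_sum, ← Finset.sum_add_distrib]
  symm
  apply Finset.sum_subset_zero_on_sdiff (Finset.Icc_subset_Icc_right hi)
  · intro j hj
    simp only [Finset.mem_sdiff, Finset.mem_Icc] at hj
    have := antitone_of_succ_lt ha (j := i + 1) (i := j) (by omega) (by omega) (by omega)
    rw [Nat.sub_eq_zero_of_le (this.trans hm), zero_mul]
  · intro j hj
    rw [Finset.mem_Icc] at hj
    have := antitone_of_succ_lt ha hj.1 hj.2 (by omega)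
    rw [← add_mul]
    congr 1
    omega

/-- explicit formula for the degree deletion function of a cluster graph
with `b i` components of size `a i + 1` (`a 1 > … > a r > a (r+1) = 0`), where
`x_i = ∑_{j=1}^{i} (a j - a i) * b j`:
(1) `f^G(x) = 0` for `x_{r+1} ≤ x ≤ |V(G)|`;
(2) for `i ∈ {1, …, r}` and `x_i ≤ x < x_{i+1}`,
    `f^G(x) = a i - ⌊(x - x_i) / (b 1 + … + b i)⌋`. -/
theorem cluster_fdel_formula (r : ℕ) (a b : ℕ → ℕ)
    (ha : ∀ i, 1 ≤ i → i ≤ r → a (i + 1) < a i)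
    (har : a (r + 1) = 0)
    (hb : ∀ i, 1 ≤ i → i ≤ r → 1 ≤ b i) :
    (∀ x : ℕ,
      (∑ j ∈ Finset.Icc 1 (r + 1), (a j - a (r + 1)) * b j) ≤ x →
      x ≤ Fintype.card (VC r a b) →
      fdel (clusterG r a b) x = 0) ∧
    (∀ i, 1 ≤ i → i ≤ r → ∀ x : ℕ,
      (∑ j ∈ Finset.Icc 1 i, (a j - a i) * b j) ≤ x →
      x < (∑ j ∈ Finset.Icc 1 (i + 1), (a j - a (i + 1)) * b j) →
      fdel (clusterG r a b) x =
        a i - (x - ∑ j ∈ Finset.Icc 1 i, (a j - a i) * b j) / (∑ j ∈ Finset.Icc 1 i, b j)) := by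
  refine ⟨fun x hx hcard => ?_, fun i hi hir x hx hx' => ?_⟩
  · rw [har] at hx
    exact Nat.le_zero.1 (fdel_clusterG_le hcard hx)
  · have hai := ha i hi hir
    have hcard : x ≤ Fintype.card (VC r a b) := by
      refine hx'.le.trans (le_trans ?_ (sum_excess_le_card r a b (a (i + 1))))
      exact Finset.sum_le_sum_of_subset (Finset.Icc_subset_Icc_right (by omega))
    rw [sum_excess_eq ha (Nat.le_succ i) (by omega) hir le_rfl hai.le] at hx'
    have hB : 0 < ∑ j ∈ Finset.Icc 1 i, b j :=
      (hb 1 le_rfl (hi.trans hir)).trans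
        (Finset.single_le_sum (f := b) (fun _ _ => Nat.zero_le _) (Finset.mem_Icc.2 ⟨le_rfl, hi⟩))
    have excess : ∀ m, a (i + 1) ≤ m → m ≤ a i → _ := fun m hm hmi =>
      sum_excess_eq (b := b) ha (hir.trans (Nat.le_succ r)) le_rfl hir hm hmi
    set X := ∑ j ∈ Finset.Icc 1 i, (a j - a i) * b j
    set B := ∑ j ∈ Finset.Icc 1 i, b j
    set q := (x - X) / B
    have hq_lt : q < a i - a (i + 1) := (Nat.div_lt_iff_lt_mul hB).2 (by omega)
    have hq_le : q * B ≤ x - X := Nat.div_mul_le_self _ _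
    have hlt_q : x - X < (q + 1) * B := Nat.lt_mul_of_div_lt (Nat.lt_succ_self _) hB
    clear_value q
    have hmem : ∑ j ∈ Finset.Icc 1 (r + 1), (a j - (a i - q)) * b j ≤ x := by
      rw [excess _ (by omega) (by omega), Nat.sub_sub_self (by omega)]
      omega
    refine le_antisymm (fdel_clusterG_le hcard hmem) ?_
    by_contra! hlt
    have h1 := (sum_tsub_mul_antitone (Finset.Icc 1 (r + 1)) a b
      (Nat.le_sub_one_of_lt hlt)).trans (sum_excess_fdel_le hcard hmem)
    simp only at h1
    rw [excess _ (by omega) (by omega), show a i - (a i - q - 1) = q + 1 by omega] at h1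
    omega

end Stmt17
end
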